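/- Hilbert's stage-II system is consistent: the formula ¬(0 = 0) is not derivable in it. -/

import Mathlib

/-- Terms of Hilbert's stage-II system: individual variables, the constant 0,
successor `+1`, and predecessor `δ`. -/
inductive Tm2 where
  | var : ℕ → Tm2
  | zero : Tm2
  | succ : Tm2 → Tm2
  | pred : Tm2 → Tm2

/-- Substitution of terms for variables in a term. -/
def Tm2.subst (σ : ℕ → Tm2) : Tm2 → Tm2
  | .var n => σ n
  | .zero => .zero
  | .succ t => .succ (t.subst σ)
  | .pred t => .pred (t.subst σ)

/-- Formulas of Hilbert's stage-II system: equations between terms, combined by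
negation, conjunction, disjunction, and implication. -/
inductive Fm2 where
  | eq : Tm2 → Tm2 → Fm2
  | neg : Fm2 → Fm2
  | conj : Fm2 → Fm2 → Fm2
  | disj : Fm2 → Fm2 → Fm2
  | imp : Fm2 → Fm2 → Fm2

/-- Substitution of terms for variables in a formula. -/
def Fm2.subst (σ : ℕ → Tm2) : Fm2 → Fm2
  | .eq s t => .eq (s.subst σ) (t.subst σ)
  | .neg A => .neg (A.subst σ)
  | .conj A B => .conj (A.subst σ) (B.subst σ)
  | .disj A B => .disj (A.subst σ) (B.subst σ)
  | .imp A B => .imp (A.subst σ) (B.subst σ)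

/-- Substitution of a single term for a single variable in a formula. -/
def Fm2.subst1 (A : Fm2) (x : ℕ) (t : Tm2) : Fm2 :=
  A.subst (fun n => if n = x then t else .var n)

/-- Derivability in Hilbert's stage-II system: propositional axiom schemas (1)–(12),
equality schemas (13)–(14), number-theoretic schemas (15)–(16), closed under
modus ponens. -/
inductive Deriv2 : Fm2 → Prop where
  | ax1 (A B : Fm2) : Deriv2 (A.imp (B.imp A))
  | ax2 (A B : Fm2) : Deriv2 ((A.imp (A.imp B)).imp (A.imp B))
  | ax3 (A B C : Fm2) : Deriv2 ((A.imp (B.imp C)).imp (B.imp (A.imp C)))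
  | ax4 (A B C : Fm2) : Deriv2 ((B.imp C).imp ((A.imp B).imp (A.imp C)))
  | ax5 (A B : Fm2) : Deriv2 ((A.conj B).imp A)
  | ax6 (A B : Fm2) : Deriv2 ((A.conj B).imp B)
  | ax7 (A B : Fm2) : Deriv2 (A.imp (B.imp (A.conj B)))
  | ax8 (A B : Fm2) : Deriv2 (A.imp (A.disj B))
  | ax9 (A B : Fm2) : Deriv2 (B.imp (A.disj B))
  | ax10 (A B C : Fm2) : Deriv2 ((A.imp C).imp ((B.imp C).imp ((A.disj B).imp C)))
  | ax11 (A B : Fm2) : Deriv2 (A.imp (A.neg.imp B))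
  | ax12 (A B : Fm2) : Deriv2 ((A.imp B).imp ((A.neg.imp B).imp B))
  | ax13 (a : Tm2) : Deriv2 (.eq a a)
  | ax14 (a b : Tm2) (A : Fm2) (x : ℕ) :
      Deriv2 ((Fm2.eq a b).imp ((A.subst1 x a).imp (A.subst1 x b)))
  | ax15 (a : Tm2) : Deriv2 (.neg (.eq a.succ .zero))
  | ax16 (a : Tm2) : Deriv2 (.eq a.succ.pred a)
  | mp (A B : Fm2) : Deriv2 A → Deriv2 (A.imp B) → Deriv2 B

/-- Value of a term in the natural numbers, under the assignment `v`. -/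
def Tm2.eval (v : ℕ → ℕ) : Tm2 → ℕ
  | .var n => v n
  | .zero => 0
  | .succ t => t.eval v + 1
  | .pred t => t.eval v - 1

/-- Truth of a formula in the natural numbers under the assignment `v`. -/
def Fm2.Holds (v : ℕ → ℕ) : Fm2 → Prop
  | .eq s t => s.eval v = t.eval v
  | .neg A => ¬ A.Holds v
  | .conj A B => A.Holds v ∧ B.Holds v
  | .disj A B => A.Holds v ∨ B.Holds v
  | .imp A B => A.Holds v → B.Holds v

theorem Tm2.eval_subst (v : ℕ → ℕ) (σ : ℕ → Tm2) (t : Tm2) :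
    (t.subst σ).eval v = t.eval fun n => (σ n).eval v := by
  induction t <;> simp_all [Tm2.subst, Tm2.eval]

theorem Fm2.holds_subst (v : ℕ → ℕ) (σ : ℕ → Tm2) (A : Fm2) :
    (A.subst σ).Holds v ↔ A.Holds fun n => (σ n).eval v := by
  induction A <;> simp_all [Fm2.subst, Fm2.Holds, Tm2.eval_subst]

theorem Fm2.holds_subst1_congr {v : ℕ → ℕ} {a b : Tm2} (h : a.eval v = b.eval v)
    (A : Fm2) (x : ℕ) : (A.subst1 x a).Holds v ↔ (A.subst1 x b).Holds v := by
  simp only [Fm2.subst1, Fm2.holds_subst, apply_ite (Tm2.eval v), h]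

/-- Every derivable formula is true in the natural numbers under every assignment. -/
theorem Deriv2.holds {A : Fm2} (h : Deriv2 A) (v : ℕ → ℕ) : A.Holds v := by
  induction h with
  | ax14 a b A x => exact fun hab => (Fm2.holds_subst1_congr hab A x).mp
  | mp A B _ _ hA hAB => exact hAB hA
  | _ => simp only [Fm2.Holds, Tm2.eval] <;> first | omega | tauto

/-- Hilbert's stage-II system is consistent: the formula ¬(0 = 0) is not derivable. -/
theorem stageII_consistent : ¬ Deriv2 (Fm2.neg (Fm2.eq Tm2.zero Tm2.zero)) := by
  exact fun h => h.holds (fun _ => 0) rfl
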